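/- Let 𝒢 be a class of groups, G ∈ 𝒢, and (Γ, g, G) a gain graph. Suppose B is a basis of Z₁(Γ; ℤ₂) consisting of circles that has an improper edge e, i.e., an edge of Γ belonging to exactly one member of B. If the graph Γ∖e (Γ with e deleted) is good with respect to 𝒢 and every circle in B is balanced in (Γ, g, G), then (Γ, g, G) is balanced. -/

import Mathlib

set_option maxHeartbeats 1000000
set_option synthInstance.maxHeartbeats 400000

attribute [local instance] Classical.propDecidable

noncomputable section

/-- A multigraph: loops and multiple edges are allowed.  Each edge `e` has a
reference orientation, from `src e` to `tgt e`. -/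
structure MGraph : Type 1 where
  V : Type
  E : Type
  src : E → V
  tgt : E → V

/-- A class of groups (a property of groups). -/
abbrev GroupClass : Type 1 := (G : Type) → Group G → Prop

/-- A subgroup-closed class of groups. -/
def SubgroupClosed (𝒢 : GroupClass) : Prop :=
  ∀ (G : Type) [instG : Group G], 𝒢 G instG → ∀ H : Subgroup G, 𝒢 H inferInstance

/-- The number of occurrences of `a` in the list `l`. -/
def countIn {α : Type} (l : List α) (a : α) : ℕ :=
  (l.map fun x => if x = a then 1 else 0).sum

namespace MGraph

/-- A step of a walk: an edge together with a direction of traversal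
(`true` = from `src` to `tgt`). -/
abbrev Step (Γ : MGraph) : Type := Γ.E × Bool

def stepStart (Γ : MGraph) (s : Γ.Step) : Γ.V := if s.2 then Γ.src s.1 else Γ.tgt s.1

def stepEnd (Γ : MGraph) (s : Γ.Step) : Γ.V := if s.2 then Γ.tgt s.1 else Γ.src s.1

/-- `IsWalkFrom Γ a b l`: the list of steps `l` is a walk from `a` to `b`. -/
inductive IsWalkFrom (Γ : MGraph) : Γ.V → Γ.V → List Γ.Step → Prop
  | nil (v : Γ.V) : IsWalkFrom Γ v v []
  | cons {a b : Γ.V} {s : Γ.Step} {l : List Γ.Step} :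
      Γ.stepStart s = a → IsWalkFrom Γ (Γ.stepEnd s) b l → IsWalkFrom Γ a b (s :: l)

section Walks

variable (Γ : MGraph)

/-- The list of edges underlying a walk. -/
def walkEdges (l : List Γ.Step) : List Γ.E := l.map Prod.fst

/-- The list of vertices visited by a walk starting at `a`. -/
def walkVerts (a : Γ.V) (l : List Γ.Step) : List Γ.V := a :: l.map Γ.stepEnd

/-- A closed walk (given as its list of steps) is simple if it is nontrivial and
repeats no edge and no vertex (except that initial vertex = final vertex). -/
def IsSimpleClosed (l : List Γ.Step) : Prop :=
  l ≠ [] ∧ (Γ.walkEdges l).Nodup ∧ (l.map Γ.stepStart).Nodup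

section Gain

variable {G : Type} [Group G]

/-- The gain of a single step, for a gain function `g`. -/
def stepGain (g : Γ.E → G) (s : Γ.Step) : G := if s.2 then g s.1 else (g s.1)⁻¹

/-- The gain of a walk: the product of the gains of its steps, in order. -/
def walkGain (g : Γ.E → G) (l : List Γ.Step) : G := (l.map (Γ.stepGain g)).prod

/-- A gain graph is balanced if every simple closed walk has gain `1`. -/
def IsBalanced (g : Γ.E → G) : Prop :=
  ∀ (v : Γ.V) (l : List Γ.Step),
    Γ.IsWalkFrom v v l → Γ.IsSimpleClosed l → Γ.walkGain g l = 1

end Gain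

/-- The mod-2 boundary map from edge chains to vertex chains. -/
def boundary : (Γ.E →₀ ZMod 2) →ₗ[ZMod 2] (Γ.V →₀ ZMod 2) :=
  Finsupp.lsum (ZMod 2) fun e => Finsupp.lsingle (Γ.src e) + Finsupp.lsingle (Γ.tgt e)

/-- The binary cycle space `Z₁(Γ; ℤ₂)`: mod-2 edge chains with even degree at
every vertex. -/
def cycleSpace : Submodule (ZMod 2) (Γ.E →₀ ZMod 2) := LinearMap.ker Γ.boundary

/-- `B` is a basis of the binary cycle space of `Γ`. -/
def IsCycleBasis (B : Set (Γ.E →₀ ZMod 2)) : Prop :=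
  (∀ c ∈ B, c ∈ Γ.cycleSpace) ∧
  LinearIndependent (ZMod 2) (fun c : B => c.1) ∧
  ∀ c ∈ Γ.cycleSpace, c ∈ Submodule.span (ZMod 2) B

/-- The closed walk `l` is a cyclic orientation of the binary cycle `c`:
it is closed and its edge multiplicities reduced mod 2 give `c`. -/
def IsCyclicOrientation (c : Γ.E →₀ ZMod 2) (l : List Γ.Step) : Prop :=
  (∃ v, Γ.IsWalkFrom v v l) ∧ ∀ e : Γ.E, c e = (countIn (Γ.walkEdges l) e : ZMod 2)

/-- The binary cycle `c` is a circle: it is the (indicator of the) edge set of a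
simple closed walk. -/
def IsCircleCycle (c : Γ.E →₀ ZMod 2) : Prop :=
  ∃ l, Γ.IsSimpleClosed l ∧ Γ.IsCyclicOrientation c l

section Tests

variable {G : Type} [Group G]

/-- `B` passes the Binary Cycle Test: it has a cyclic orientation all of whose
closed walks have gain `1`. -/
def PassesBCT (g : Γ.E → G) (B : Set (Γ.E →₀ ZMod 2)) : Prop :=
  ∀ c ∈ B, ∃ l, Γ.IsCyclicOrientation c l ∧ Γ.walkGain g l = 1

/-- The Binary Cycle Test is valid for the gain graph `(Γ, g, G)`. -/
def BCTValid (g : Γ.E → G) : Prop :=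
  (∃ B, Γ.IsCycleBasis B ∧ Γ.PassesBCT g B) → Γ.IsBalanced g

/-- `c` is a circle whose natural traversal as a simple closed walk has gain 1. -/
def IsBalancedCircleCycle (g : Γ.E → G) (c : Γ.E →₀ ZMod 2) : Prop :=
  ∃ l, Γ.IsSimpleClosed l ∧ Γ.IsCyclicOrientation c l ∧ Γ.walkGain g l = 1

/-- The Circle Test is valid for the gain graph `(Γ, g, G)`: if some basis of the
binary cycle space consists of balanced circles, then the gain graph is balanced. -/
def CircleTestValid (g : Γ.E → G) : Prop :=
  (∃ B, Γ.IsCycleBasis B ∧ ∀ c ∈ B, Γ.IsBalancedCircleCycle g c) → Γ.IsBalanced g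

end Tests

/-- The Binary Cycle Test is valid for `Γ` with respect to the class `𝒢`. -/
def BCTValidFor (𝒢 : GroupClass) : Prop :=
  ∀ (G : Type) [instG : Group G], 𝒢 G instG → ∀ g : Γ.E → G, Γ.BCTValid g

/-- The Circle Test is valid for `Γ` with respect to the class `𝒢`
(`Γ` is a "good" graph for `𝒢`). -/
def CircleTestValidFor (𝒢 : GroupClass) : Prop :=
  ∀ (G : Type) [instG : Group G], 𝒢 G instG → ∀ g : Γ.E → G, Γ.CircleTestValid g

/-- Deletion of a set of edges. -/
def deleteEdges (S : Set Γ.E) : MGraph where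
  V := Γ.V
  E := {e : Γ.E // e ∉ S}
  src e := Γ.src e.1
  tgt e := Γ.tgt e.1

/-- The relation identifying the two endpoints of each edge of `S`. -/
def contractRel (S : Set Γ.E) : Γ.V → Γ.V → Prop :=
  fun x y => ∃ e ∈ S, Γ.src e = x ∧ Γ.tgt e = y

/-- Contraction `Γ/S`: vertices in the same component of `(V, S)` are identified
and the edges of `S` are deleted. -/
def contract (S : Set Γ.E) : MGraph where
  V := Quot (Γ.contractRel S)
  E := {e : Γ.E // e ∉ S}
  src e := Quot.mk _ (Γ.src e.1)
  tgt e := Quot.mk _ (Γ.tgt e.1)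

/-- The subgraph with vertex set `U` and edge set the edges of `T` having both
endpoints in `U`. -/
def subgraph (U : Set Γ.V) (T : Set Γ.E) : MGraph where
  V := U
  E := {e : Γ.E // e ∈ T ∧ Γ.src e ∈ U ∧ Γ.tgt e ∈ U}
  src e := ⟨Γ.src e.1, e.2.2.1⟩
  tgt e := ⟨Γ.tgt e.1, e.2.2.2⟩

/-- The set of vertices incident with an edge of `D`. -/
def edgeVerts (D : Set Γ.E) : Set Γ.V := {x | ∃ e ∈ D, Γ.src e = x ∨ Γ.tgt e = x}

/-- The subgraph spanned by an edge set `D`. -/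
def edgeSubgraph (D : Set Γ.E) : MGraph := Γ.subgraph (Γ.edgeVerts D) D

/-- Adjacency of vertices. -/
def Adj (x y : Γ.V) : Prop :=
  ∃ e : Γ.E, (Γ.src e = x ∧ Γ.tgt e = y) ∨ (Γ.src e = y ∧ Γ.tgt e = x)

/-- A graph with no loops. -/
def Loopless : Prop := ∀ e : Γ.E, Γ.src e ≠ Γ.tgt e

/-- A finite graph. -/
def IsFiniteGraph : Prop := Finite Γ.V ∧ Finite Γ.E

/-- A graph is inseparable if any two distinct edges lie in a common circle. -/
def Inseparable : Prop :=
  ∀ e f : Γ.E, e ≠ f →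
    ∃ (v : Γ.V) (l : List Γ.Step), Γ.IsWalkFrom v v l ∧ Γ.IsSimpleClosed l ∧
      e ∈ Γ.walkEdges l ∧ f ∈ Γ.walkEdges l

/-- `D` is (the edge set of) a block of `Γ`: a maximal inseparable subgraph. -/
def IsBlock (D : Set Γ.E) : Prop :=
  (Γ.edgeSubgraph D).Inseparable ∧
  ∀ D', D ⊆ D' → (Γ.edgeSubgraph D').Inseparable → D' = D

/-- The edge set `D` is a circle of `Γ`. -/
def IsCircleSet (D : Set Γ.E) : Prop :=
  ∃ (v : Γ.V) (l : List Γ.Step), Γ.IsWalkFrom v v l ∧ Γ.IsSimpleClosed l ∧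
    D = {e | e ∈ Γ.walkEdges l}

/-- The edge set `D` is a balanced circle for the gain function `g`. -/
def IsBalancedCircleSet {G : Type} [Group G] (g : Γ.E → G) (D : Set Γ.E) : Prop :=
  Γ.IsCircleSet D ∧
  ∀ (v : Γ.V) (l : List Γ.Step), Γ.IsWalkFrom v v l → Γ.IsSimpleClosed l →
    D = {e | e ∈ Γ.walkEdges l} → Γ.walkGain g l = 1

end Walks

/-- An isomorphism of multigraphs (preserving endpoints as unordered pairs). -/
structure Iso (Γ Δ : MGraph) where
  vEquiv : Γ.V ≃ Δ.V
  eEquiv : Γ.E ≃ Δ.E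
  ends_eq : ∀ e : Γ.E,
    s(Δ.src (eEquiv e), Δ.tgt (eEquiv e)) = s(vEquiv (Γ.src e), vEquiv (Γ.tgt e))

/-- `Δ` is a minor of `Γ`: `Δ` is isomorphic to a subgraph of a contraction of `Γ`. -/
def IsMinor (Δ Γ : MGraph) : Prop :=
  ∃ (S : Set Γ.E) (U : Set (Γ.contract S).V) (T : Set (Γ.contract S).E),
    Nonempty (Iso Δ ((Γ.contract S).subgraph U T))

/-- Subdivision of the edge `e₀` into a path of length two. -/
def subdivide (Γ : MGraph) (e₀ : Γ.E) : MGraph where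
  V := Γ.V ⊕ Unit
  E := Γ.E ⊕ Unit
  src := fun e => match e with
    | .inl e => Sum.inl (Γ.src e)
    | .inr _ => Sum.inr ()
  tgt := fun e => match e with
    | .inl e => if e = e₀ then Sum.inr () else Sum.inl (Γ.tgt e)
    | .inr _ => Sum.inl (Γ.tgt e₀)

/-- One subdivision step (up to isomorphism). -/
def SubdivisionStep (A B : MGraph) : Prop :=
  Nonempty (Iso B A) ∨ ∃ e₀ : A.E, Nonempty (Iso B (A.subdivide e₀))

/-- `Δ` is (isomorphic to) a graph obtained from `Γ₀` by subdividing edges. -/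
def IsSubdivisionOf (Δ Γ₀ : MGraph) : Prop :=
  ∃ Δ', Relation.ReflTransGen SubdivisionStep Γ₀ Δ' ∧ Nonempty (Iso Δ Δ')

/-- Two graphs are homeomorphic if both are obtained by subdividing edges of a
common graph. -/
def Homeomorphic (Γ₁ Γ₂ : MGraph) : Prop :=
  ∃ Γ₀, IsSubdivisionOf Γ₁ Γ₀ ∧ IsSubdivisionOf Γ₂ Γ₀

section Ops

variable (Γ : MGraph)

/-- Interchange `u` and `v`. -/
def twistVert (u v x : Γ.V) : Γ.V := if x = u then v else if x = v then u else x

/-- The result of twisting the edge set `A` across `{u, v}`: every endpoint of an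
edge of `A` at `u` is reconnected to `v` and vice versa. -/
def twist (u v : Γ.V) (A : Set Γ.E) : MGraph where
  V := Γ.V
  E := Γ.E
  src e := if e ∈ A then Γ.twistVert u v (Γ.src e) else Γ.src e
  tgt e := if e ∈ A then Γ.twistVert u v (Γ.tgt e) else Γ.tgt e

/-- `x` and `y` are joined by a walk all of whose vertices avoid `u` and `v`. -/
def AvoidConn (u v x y : Γ.V) : Prop :=
  ∃ l, Γ.IsWalkFrom x y l ∧ ∀ z ∈ Γ.walkVerts x l, z ≠ u ∧ z ≠ v

/-- `P` is the vertex set of a union of some, but not all, of the components of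
`Γ ∖ {u, v}` (the data of a Whitney twist across the 2-separation `{u,v}`). -/
def IsWhitneyTwistData (u v : Γ.V) (P : Set Γ.V) : Prop :=
  (∀ x ∈ P, x ≠ u ∧ x ≠ v) ∧
  (∀ x ∈ P, ∀ y, Γ.AvoidConn u v x y → y ∈ P) ∧
  P.Nonempty ∧ (∃ y : Γ.V, y ∉ P ∧ y ≠ u ∧ y ≠ v)

/-- `(v, w, F)` is valid data for extruding the vertex `v`: `w` is a neighbor of
`v` and `F` is a nonempty set of edges joining `v` and `w`. -/
def IsExtrusionData (v w : Γ.V) (F : Set Γ.E) : Prop :=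
  v ≠ w ∧ F.Nonempty ∧
  ∀ e ∈ F, (Γ.src e = v ∧ Γ.tgt e = w) ∨ (Γ.src e = w ∧ Γ.tgt e = v)

/-- Extrusion of a new vertex `v′` from `v`: the edges of `F` are reattached to
join `v′` to `w`, and a new edge joins `v` to `v′`. -/
def extrude (v w : Γ.V) (F : Set Γ.E) : MGraph where
  V := Γ.V ⊕ Unit
  E := Γ.E ⊕ Unit
  src := fun e => match e with
    | .inl e => if e ∈ F ∧ Γ.src e = v then Sum.inr () else Sum.inl (Γ.src e)
    | .inr _ => Sum.inl v
  tgt := fun e => match e with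
    | .inl e => if e ∈ F ∧ Γ.tgt e = v then Sum.inr () else Sum.inl (Γ.tgt e)
    | .inr _ => Sum.inr ()

end Ops

/-- `Δ` is obtained from `Γ` by extruding a vertex (up to isomorphism). -/
def IsExtrusionOf (Δ Γ : MGraph) : Prop :=
  ∃ (v w : Γ.V) (F : Set Γ.E),
    Γ.IsExtrusionData v w F ∧ Nonempty (Iso Δ (Γ.extrude v w F))

/-- `Γ` is extrusion-irreducible: it is not obtainable by extrusion from a
smaller graph. -/
def ExtrusionIrreducible (Γ : MGraph) : Prop := ¬ ∃ Δ : MGraph, IsExtrusionOf Γ Δ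

/-- `Δ` is obtained from `Γ₀` by a (possibly empty) sequence of extrusions,
up to isomorphism. -/
def ObtainedByExtrusions (Δ Γ₀ : MGraph) : Prop :=
  ∃ Δ', Relation.ReflTransGen (fun A B => IsExtrusionOf B A) Γ₀ Δ' ∧ Nonempty (Iso Δ Δ')

section Bridges

variable (Γ : MGraph)

/-- The walk `l` is internally disjoint from `{u, v}`. -/
def IntDisjWalk (u v : Γ.V) (l : List Γ.Step) : Prop :=
  ∀ z ∈ (l.map Γ.stepEnd).dropLast, z ≠ u ∧ z ≠ v

/-- Two edges lie in a common walk internally disjoint from `{u, v}`. -/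
def InBridgeRel (u v : Γ.V) (e f : Γ.E) : Prop :=
  ∃ (a b : Γ.V) (l : List Γ.Step), Γ.IsWalkFrom a b l ∧ Γ.IntDisjWalk u v l ∧
    e ∈ Γ.walkEdges l ∧ f ∈ Γ.walkEdges l

/-- `D` is (the edge set of) a bridge of `{u, v}`: a maximal set of edges any two
of which lie in a common walk internally disjoint from `{u, v}`. -/
def IsBridge (u v : Γ.V) (D : Set Γ.E) : Prop :=
  D.Nonempty ∧ (∀ e ∈ D, ∀ f ∈ D, Γ.InBridgeRel u v e f) ∧
  ∀ D', D ⊆ D' → (∀ e ∈ D', ∀ f ∈ D', Γ.InBridgeRel u v e f) → D' = D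

/-- The set `A` of vertices is connected using only edges of `D`, within `A`. -/
def SetConnWith (D : Set Γ.E) (A : Set Γ.V) : Prop :=
  ∀ x ∈ A, ∀ y ∈ A, ∃ l, Γ.IsWalkFrom x y l ∧ (∀ s ∈ l, s.1 ∈ D) ∧
    ∀ z ∈ Γ.walkVerts x l, z ∈ A

/-- The subgraph with edge set `D` has `2P_{2uv}` (a four-circle with `u`, `v` as
opposite vertices) as a minor rooted at `u` and `v`, expressed by branch sets. -/
def HasRooted2P2Minor (u v : Γ.V) (D : Set Γ.E) : Prop :=
  ∃ β : Fin 4 → Set Γ.V,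
    (∀ i j, i ≠ j → Disjoint (β i) (β j)) ∧
    (∀ i, (β i).Nonempty ∧ Γ.SetConnWith D (β i)) ∧
    u ∈ β 0 ∧ v ∈ β 2 ∧
    ∀ i : Fin 4, ∃ e ∈ D,
      (Γ.src e ∈ β i ∧ Γ.tgt e ∈ β (i + 1)) ∨ (Γ.src e ∈ β (i + 1) ∧ Γ.tgt e ∈ β i)

/-- Removing the vertex `w` disconnects the subgraph with edge set `D`. -/
def SeparatesBridge (D : Set Γ.E) (w : Γ.V) : Prop :=
  ∃ x ∈ Γ.edgeVerts D, ∃ y ∈ Γ.edgeVerts D, x ≠ w ∧ y ≠ w ∧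
    ¬ ∃ l, Γ.IsWalkFrom x y l ∧ (∀ s ∈ l, s.1 ∈ D) ∧ ∀ z ∈ Γ.walkVerts x l, z ≠ w

end Bridges

/-! ### Particular graphs -/

/-- `K₁°`: one vertex with one loop. -/
@[reducible] def loopGraph : MGraph where
  V := Unit
  E := Unit
  src _ := ()
  tgt _ := ()

/-- `mK₂`: two vertices joined by `m` parallel edges. -/
@[reducible] def banana (m : ℕ) : MGraph where
  V := Bool
  E := Fin m
  src _ := false
  tgt _ := true

/-- `C_l(m₁, …, m_l)`: a circle of length `l` whose `i`-th edge is replaced by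
`m i` parallel copies. -/
@[reducible] def multiCircle (l : ℕ) (m : Fin l → ℕ) : MGraph where
  V := Fin l
  E := Σ i : Fin l, Fin (m i)
  src e := e.1
  tgt e := ⟨(e.1.1 + 1) % l, Nat.mod_lt _ e.1.pos⟩

/-- `2C_n`: the circle of length `n` with every edge doubled. -/
@[reducible] def twoCircle (n : ℕ) : MGraph := multiCircle n fun _ => 2

/-- `K₄(m, m′)`: `K₄` with two opposite (nonadjacent) edges replaced by `m` and
`m′` parallel copies respectively. -/
@[reducible] def K4m (m m' : ℕ) : MGraph where
  V := Fin 4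
  E := (Fin m ⊕ Fin m') ⊕ Fin 4
  src := fun e => match e with
    | .inl (.inl _) => 0
    | .inl (.inr _) => 2
    | .inr j => ![0, 0, 1, 1] j
  tgt := fun e => match e with
    | .inl (.inl _) => 1
    | .inl (.inr _) => 3
    | .inr j => ![2, 3, 2, 3] j

/-- `K₄''`: `K₄` with two adjacent edges doubled. -/
@[reducible] def K4dd : MGraph where
  V := Fin 4
  E := Fin 8
  src := ![0, 0, 0, 0, 0, 1, 1, 2]
  tgt := ![1, 1, 2, 2, 3, 2, 3, 3]

/-- The `n`-spoke wheel `W_n`: rim vertices `Fin n` and a hub; `inl i` is the rim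
edge from `v_i` to `v_{i+1}` and `inr i` is the spoke from the hub to `v_i`. -/
@[reducible] def wheel (n : ℕ) : MGraph where
  V := Fin n ⊕ Unit
  E := Fin n ⊕ Fin n
  src := fun e => match e with
    | .inl i => Sum.inl i
    | .inr _ => Sum.inr ()
  tgt := fun e => match e with
    | .inl i => Sum.inl ⟨(i.1 + 1) % n, Nat.mod_lt _ i.pos⟩
    | .inr i => Sum.inl i

instance (n : ℕ) : Finite ((wheel n).E) := inferInstanceAs (Finite (Fin n ⊕ Fin n))

/-- The indicator of an edge set, as a binary chain. -/
def indicatorCycle (Γ : MGraph) [Finite Γ.E] (D : Set Γ.E) : Γ.E →₀ ZMod 2 :=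
  Finsupp.equivFunOnFinite.symm fun e => if e ∈ D then 1 else 0

/-- The edge set of the Hamiltonian circle of `W_n` omitting the rim edge `r`:
all rim edges except `r`, together with the two spokes at the ends of `r`. -/
def wheelHamSet (n : ℕ) (r : Fin n) : Set (wheel n).E :=
  {e | Sum.elim (fun j : Fin n => j ≠ r)
      (fun j : Fin n => j = r ∨ j = ⟨(r.1 + 1) % n, Nat.mod_lt _ r.pos⟩) e}

/-- The set of (indicators of) the `n` Hamiltonian circles of the wheel `W_n`. -/
def wheelHamBasis (n : ℕ) : Set ((wheel n).E →₀ ZMod 2) :=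
  {c | ∃ r : Fin n, c = indicatorCycle (wheel n) (wheelHamSet n r)}

/-- A theta graph: a graph homeomorphic to a triple link. -/
def IsThetaGraph (Δ : MGraph) : Prop := Homeomorphic Δ (banana 3)

end MGraph

end

namespace MGraph

section Aux

variable {Γ : MGraph}

theorem IsWalkFrom.append' {a b c : Γ.V} {l m : List Γ.Step}
    (h : Γ.IsWalkFrom a b l) (h' : Γ.IsWalkFrom b c m) : Γ.IsWalkFrom a c (l ++ m) := by
  induction h with
  | nil v => simpa using h'
  | cons hs _ ih => exact IsWalkFrom.cons hs (ih h')

theorem IsWalkFrom.split' {a c : Γ.V} {l m : List Γ.Step}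
    (h : Γ.IsWalkFrom a c (l ++ m)) : ∃ b, Γ.IsWalkFrom a b l ∧ Γ.IsWalkFrom b c m := by
  induction l generalizing a with
  | nil => exact ⟨a, .nil a, h⟩
  | cons s l ih =>
    cases h with
    | cons hs hw =>
      obtain ⟨b, h1, h2⟩ := ih hw
      exact ⟨b, .cons hs h1, h2⟩

theorem IsWalkFrom.cons_inv {a c : Γ.V} {s : Γ.Step} {m : List Γ.Step}
    (h : Γ.IsWalkFrom a c (s :: m)) : Γ.stepStart s = a ∧ Γ.IsWalkFrom (Γ.stepEnd s) c m := by
  cases h with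
  | cons hs hw => exact ⟨hs, hw⟩

theorem IsWalkFrom.nil_inv {a c : Γ.V} (h : Γ.IsWalkFrom a c []) : a = c := by
  cases h; rfl

/-- Reversal of a step. -/
def revStep (s : Γ.Step) : Γ.Step := (s.1, !s.2)

theorem stepStart_rev (s : Γ.Step) : Γ.stepStart (revStep s) = Γ.stepEnd s := by
  rcases s with ⟨e, _ | _⟩ <;> simp [revStep, stepStart, stepEnd]

theorem stepEnd_rev (s : Γ.Step) : Γ.stepEnd (revStep s) = Γ.stepStart s := by
  rcases s with ⟨e, _ | _⟩ <;> simp [revStep, stepStart, stepEnd]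

variable {G : Type} [Group G]

theorem stepGain_rev (g : Γ.E → G) (s : Γ.Step) :
    Γ.stepGain g (revStep s) = (Γ.stepGain g s)⁻¹ := by
  rcases s with ⟨e, _ | _⟩ <;> simp [revStep, stepGain]

theorem walkGain_nil (g : Γ.E → G) : Γ.walkGain g [] = 1 := rfl

theorem walkGain_cons (g : Γ.E → G) (s : Γ.Step) (l : List Γ.Step) :
    Γ.walkGain g (s :: l) = Γ.stepGain g s * Γ.walkGain g l := by simp [walkGain]

theorem walkGain_append (g : Γ.E → G) (l m : List Γ.Step) :
    Γ.walkGain g (l ++ m) = Γ.walkGain g l * Γ.walkGain g m := by simp [walkGain]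

theorem exists_rev (g : Γ.E → G) {a b : Γ.V} {l : List Γ.Step} (h : Γ.IsWalkFrom a b l) :
    ∃ m, Γ.IsWalkFrom b a m ∧ Γ.walkGain g m = (Γ.walkGain g l)⁻¹ := by
  induction h with
  | nil v => exact ⟨[], .nil v, by simp [walkGain]⟩
  | @cons a b s l hs hw ih =>
    obtain ⟨m, hm, hg⟩ := ih
    refine ⟨m ++ [revStep s], hm.append' (.cons (stepStart_rev s) ?_), ?_⟩
    · rw [stepEnd_rev, hs]; exact .nil _
    · simp [walkGain_append, walkGain_cons, walkGain_nil, hg, stepGain_rev]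

/-- A list with a repeated image under `f` splits accordingly. -/
theorem exists_dup {α β : Type} (f : α → β) (l : List α) (h : ¬ (l.map f).Nodup) :
    ∃ a x m y b, l = a ++ x :: (m ++ y :: b) ∧ f x = f y := by
  induction l with
  | nil => simp at h
  | cons x l ih =>
    by_cases hx : f x ∈ l.map f
    · obtain ⟨y, hy, hxy⟩ := List.mem_map.1 hx
      obtain ⟨m, b, rfl⟩ := List.append_of_mem hy
      exact ⟨[], x, m, y, b, rfl, hxy.symm⟩
    · have : ¬ (l.map f).Nodup := by
        intro h'
        exact h (by rw [List.map_cons]; exact List.nodup_cons.2 ⟨hx, h'⟩)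
      obtain ⟨a, x', m, y, b, rfl, hf⟩ := ih this
      exact ⟨x :: a, x', m, y, b, rfl, hf⟩

/-- In a balanced gain graph all closed walks have identity gain. -/
theorem IsBalanced.closed (g : Γ.E → G) (hb : Γ.IsBalanced g) :
    ∀ (n : ℕ) (v : Γ.V) (l : List Γ.Step), l.length ≤ n → Γ.IsWalkFrom v v l →
      Γ.walkGain g l = 1 := by
  intro n
  induction n with
  | zero =>
    intro v l hl _
    have : l = [] := List.eq_nil_of_length_eq_zero (by omega)
    subst this; rfl
  | succ n ih =>
    intro v l hl hw
    by_cases hne : l = []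
    · subst hne; rfl
    by_cases hst : (l.map Γ.stepStart).Nodup
    · by_cases hed : (Γ.walkEdges l).Nodup
      · exact hb v l hw ⟨hne, hed, hst⟩
      · obtain ⟨a, x, m, y, b, rfl, hxy⟩ := exists_dup _ _ hed
        obtain ⟨p, h1, h2⟩ := hw.split'
        obtain ⟨hx, h3⟩ := h2.cons_inv
        obtain ⟨q, h4, h5⟩ := h3.split'
        obtain ⟨hy, h6⟩ := h5.cons_inv
        have hne' : Γ.stepStart x ≠ Γ.stepStart y := by
          intro hh
          simp [List.nodup_append, hh] at hst
        have hyx : y = revStep x := by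
          rcases x with ⟨x1, x2⟩
          rcases y with ⟨y1, y2⟩
          simp only at hxy
          subst hxy
          cases x2 <;> cases y2 <;> simp_all [revStep]
        subst hyx
        rw [stepStart_rev] at hy
        rw [stepEnd_rev] at h6
        have hm : m = [] := by
          cases m with
          | nil => rfl
          | cons z m =>
            exfalso
            have hz := h4.cons_inv.1
            simp [List.nodup_append, stepStart_rev, hz] at hst
        subst hm
        have := ih v (a ++ b) (by simp at hl ⊢; omega) (h1.append' (hx ▸ h6))
        simpa [walkGain_append, walkGain_cons, stepGain_rev] using this
    · obtain ⟨a, x, m, y, b, rfl, hxy⟩ := exists_dup _ _ hst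
      obtain ⟨p, h1, h2⟩ := hw.split'
      rw [← List.cons_append] at h2
      obtain ⟨q, h4, h5⟩ := h2.split'
      have hx := h4.cons_inv.1
      have hy := h5.cons_inv.1
      have hpq : p = q := by rw [← hx, ← hy, hxy]
      subst hpq
      have e1 := ih v (a ++ y :: b) (by simp at hl ⊢; omega) (h1.append' h5)
      have e2 := ih p (x :: m) (by simp at hl ⊢; omega) h4
      rw [← List.cons_append, walkGain_append, walkGain_append, e2, one_mul, ← walkGain_append, e1]

variable {S : Set Γ.E}

/-- Steps of the deletion as steps of the graph. -/
def upStep (s : (Γ.deleteEdges S).Step) : Γ.Step := (s.1.1, s.2)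

theorem up_start (s : (Γ.deleteEdges S).Step) :
    Γ.stepStart (upStep s) = (Γ.deleteEdges S).stepStart s := rfl

theorem up_end (s : (Γ.deleteEdges S).Step) :
    Γ.stepEnd (upStep s) = (Γ.deleteEdges S).stepEnd s := rfl

theorem up_gain (g : Γ.E → G) (l : List (Γ.deleteEdges S).Step) :
    Γ.walkGain g (l.map upStep) = (Γ.deleteEdges S).walkGain (fun x => g x.1) l := by
  unfold walkGain
  rw [List.map_map]
  rfl

theorem exists_up (l : List Γ.Step) (h : ∀ s ∈ l, s.1 ∉ S) :
    ∃ m : List (Γ.deleteEdges S).Step, l = m.map upStep := by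
  induction l with
  | nil => exact ⟨[], rfl⟩
  | cons s l ih =>
    obtain ⟨m, rfl⟩ := ih fun t ht => h t (List.mem_cons_of_mem _ ht)
    exact ⟨(⟨s.1, h s List.mem_cons_self⟩, s.2) :: m, rfl⟩

theorem down_walk {a b : Γ.V} {m : List (Γ.deleteEdges S).Step}
    (h : Γ.IsWalkFrom a b (m.map upStep)) : (Γ.deleteEdges S).IsWalkFrom a b m := by
  induction m generalizing a with
  | nil =>
    have := h.nil_inv
    subst this
    exact IsWalkFrom.nil (Γ := Γ.deleteEdges S) a
  | cons s m ih =>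
    obtain ⟨h1, h2⟩ := h.cons_inv
    exact IsWalkFrom.cons (Γ := Γ.deleteEdges S) h1 (ih h2)

theorem countIn_cons {α : Type} (x : α) (l : List α) (a : α) :
    countIn (x :: l) a = (if x = a then 1 else 0) + countIn l a := by
  simp [countIn]

theorem countIn_eq_zero {α : Type} (l : List α) (a : α) (h : a ∉ l) : countIn l a = 0 := by
  induction l with
  | nil => rfl
  | cons x l ih =>
    simp only [List.mem_cons, not_or] at h
    rw [countIn_cons, ih h.2, if_neg (fun hh => h.1 hh.symm)]

theorem countIn_eq_one {α : Type} (l : List α) (a : α) (hn : l.Nodup) (h : a ∈ l) :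
    countIn l a = 1 := by
  induction l with
  | nil => simp at h
  | cons x l ih =>
    rw [List.nodup_cons] at hn
    rw [countIn_cons]
    by_cases hx : x = a
    · subst hx
      rw [countIn_eq_zero _ _ hn.1, if_pos rfl]
    · rw [if_neg hx, ih hn.2 (by simpa [Ne.symm hx] using h)]

theorem countIn_map {α β : Type} (f : α → β) (hf : Function.Injective f) (l : List α) (a : α) :
    countIn (l.map f) (f a) = countIn l a := by
  induction l with
  | nil => rfl
  | cons x l ih => simp only [List.map_cons, countIn_cons, ih, hf.eq_iff]

/-- Extension of chains by zero. -/
noncomputable def emb (Γ : MGraph) (S : Set Γ.E) :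
    ((Γ.deleteEdges S).E →₀ ZMod 2) →ₗ[ZMod 2] (Γ.E →₀ ZMod 2) :=
  Finsupp.lmapDomain (ZMod 2) (ZMod 2) (fun x : (Γ.deleteEdges S).E => (x.1 : Γ.E))

theorem emb_injective : Function.Injective (emb Γ S) :=
  Finsupp.mapDomain_injective (fun _ _ h => Subtype.ext h)

theorem emb_apply (c : (Γ.deleteEdges S).E →₀ ZMod 2) (x : (Γ.deleteEdges S).E) :
    emb Γ S c x.1 = c x :=
  Finsupp.mapDomain_apply (f := fun x : (Γ.deleteEdges S).E => (x.1 : Γ.E))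
    (fun _ _ h => Subtype.ext h) c x

theorem emb_apply_mem (c : (Γ.deleteEdges S).E →₀ ZMod 2) (x : Γ.E) (hx : x ∈ S) :
    emb Γ S c x = 0 := by
  apply Finsupp.mapDomain_of_notMem_range
  rintro ⟨y, rfl⟩
  exact y.2 hx

theorem exists_emb (c : Γ.E →₀ ZMod 2) (h : ∀ x ∈ S, c x = 0) : ∃ c', emb Γ S c' = c := by
  refine ⟨Finsupp.comapDomain (fun x : (Γ.deleteEdges S).E => (x.1 : Γ.E)) c
    (fun _ _ _ _ h => Subtype.ext h), ?_⟩
  ext x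
  by_cases hx : x ∈ S
  · rw [emb_apply_mem _ _ hx, h x hx]
  · exact emb_apply _ (⟨x, hx⟩ : (Γ.deleteEdges S).E)

theorem boundary_single (Δ : MGraph) (x : Δ.E) (r : ZMod 2) :
    Δ.boundary (Finsupp.single x r) = Finsupp.single (Δ.src x) r + Finsupp.single (Δ.tgt x) r := by
  simp [boundary]

theorem boundary_emb (c : (Γ.deleteEdges S).E →₀ ZMod 2) :
    Γ.boundary (emb Γ S c) = (Γ.deleteEdges S).boundary c := by
  have : Γ.boundary.comp (emb Γ S) = (Γ.deleteEdges S).boundary := by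
    apply Finsupp.lhom_ext
    intro x r
    have h1 : emb Γ S (Finsupp.single x r) = Finsupp.single x.1 r := Finsupp.mapDomain_single
    exact (congrArg Γ.boundary h1).trans ((boundary_single Γ x.1 r).trans
      (boundary_single (Γ.deleteEdges S) x r).symm)
  exact LinearMap.congr_fun this c

theorem basis_delete (B : Set (Γ.E →₀ ZMod 2)) (hB : Γ.IsCycleBasis B) (e : Γ.E)
    (himp : ∃! c, c ∈ B ∧ c e ≠ 0) :
    (Γ.deleteEdges {e}).IsCycleBasis {c | emb Γ {e} c ∈ B} := by
  obtain ⟨hB1, hB2, hB3⟩ := hB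
  obtain ⟨C, ⟨hC, hCe⟩, huniq⟩ := himp
  refine ⟨?_, ?_, ?_⟩
  · intro c hc
    have := hB1 _ hc
    rw [cycleSpace, LinearMap.mem_ker] at this ⊢
    rw [← boundary_emb, this]; rfl
  · apply LinearIndependent.of_comp (emb Γ {e})
    exact hB2.comp (fun c : {c | emb Γ {e} c ∈ B} => (⟨emb Γ {e} c.1, c.2⟩ : B))
      (fun a b h => Subtype.ext (emb_injective (congrArg Subtype.val h)))
  · intro c hc
    have h1 : emb Γ {e} c ∈ Submodule.span (ZMod 2) B := by
      apply hB3
      rw [cycleSpace, LinearMap.mem_ker] at hc ⊢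
      rw [boundary_emb, hc]; rfl
    have hins : B = insert C (emb Γ {e} '' {c | emb Γ {e} c ∈ B}) := by
      ext d
      constructor
      · intro hd
        by_cases hde : d e = 0
        · obtain ⟨d', rfl⟩ := exists_emb (S := {e}) d (by rintro x rfl; exact hde)
          exact Or.inr ⟨d', hd, rfl⟩
        · exact Or.inl (huniq d ⟨hd, hde⟩)
      · rintro (rfl | ⟨d', hd, rfl⟩)
        · exact hC
        · exact hd
    rw [hins, Submodule.mem_span_insert] at h1
    obtain ⟨a, z, hz, hcz⟩ := h1
    rw [Submodule.span_image] at hz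
    obtain ⟨z', hz', rfl⟩ := hz
    have ha : a = 0 := by
      have := congrArg (fun f : Γ.E →₀ ZMod 2 => f e) hcz
      simp only [Finsupp.add_apply, Finsupp.smul_apply, smul_eq_mul] at this
      rw [emb_apply_mem _ _ (Set.mem_singleton e), emb_apply_mem _ _ (Set.mem_singleton e),
        add_zero] at this
      exact (mul_eq_zero.1 this.symm).resolve_right hCe
    subst ha
    rw [zero_smul, zero_add] at hcz
    rw [emb_injective hcz]
    exact hz'

theorem balanced_delete (g : Γ.E → G) (e : Γ.E) (c : (Γ.deleteEdges {e}).E →₀ ZMod 2)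
    (h : Γ.IsBalancedCircleCycle g (emb Γ {e} c)) :
    (Γ.deleteEdges {e}).IsBalancedCircleCycle (fun x => g x.1) c := by
  obtain ⟨l, ⟨hne, hed, hst⟩, ⟨⟨v, hw⟩, hcount⟩, hg⟩ := h
  have he : e ∉ Γ.walkEdges l := by
    intro he
    have := hcount e
    rw [emb_apply_mem _ _ (Set.mem_singleton e), countIn_eq_one _ _ hed he] at this
    simp at this
  obtain ⟨m, rfl⟩ := exists_up (S := {e}) l (by
    intro s hs hse
    exact he (List.mem_map.2 ⟨s, hs, hse⟩))
  have hE : Γ.walkEdges (m.map upStep)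
      = ((Γ.deleteEdges {e}).walkEdges m).map (fun x => (x.1 : Γ.E)) := by
    unfold walkEdges
    rw [List.map_map, List.map_map]
    rfl
  rw [hE] at hed
  refine ⟨m, ⟨?_, ?_, ?_⟩, ⟨⟨v, down_walk hw⟩, ?_⟩, ?_⟩
  · rintro rfl; exact hne rfl
  · exact List.Nodup.of_map _ hed
  · rw [List.map_map] at hst
    exact hst
  · intro x
    rw [← emb_apply, hcount, hE]
    rw [countIn_map (fun x : (Γ.deleteEdges {e}).E => (x.1 : Γ.E)) (fun _ _ h => Subtype.ext h)]
  · rw [← up_gain, hg]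

end Aux

end MGraph

open MGraph in
/-- Suppose `B` is a circle basis of the binary cycle space of
`Γ` having an improper edge `e` (an edge lying in exactly one member of `B`).
If `Γ ∖ e` is good with respect to `𝒢` and every circle of `B` is balanced in
the gain graph `(Γ, g, G)` with `G ∈ 𝒢`, then `(Γ, g, G)` is balanced. -/
theorem improper_edge_implies_balance (𝒢 : GroupClass) (Γ : MGraph)
    (G : Type) [instG : Group G] (hG : 𝒢 G instG) (g : Γ.E → G)
    (B : Set (Γ.E →₀ ZMod 2)) (hB : Γ.IsCycleBasis B)
    (hcirc : ∀ c ∈ B, Γ.IsCircleCycle c)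
    (e : Γ.E) (himp : ∃! c, c ∈ B ∧ c e ≠ 0)
    (hgood : (Γ.deleteEdges {e}).CircleTestValidFor 𝒢)
    (hbal : ∀ c ∈ B, Γ.IsBalancedCircleCycle g c) :
    Γ.IsBalanced g := by
  have hdel : (Γ.deleteEdges {e}).IsBalanced (fun x => g x.1) :=
    hgood G hG _ ⟨_, basis_delete B hB e himp, fun c hc => balanced_delete g e c (hbal _ hc)⟩
  let R : Γ.V → Γ.V → G → Prop := fun a b h =>
    ∃ l, (Γ.deleteEdges {e}).IsWalkFrom a b l ∧
      (Γ.deleteEdges {e}).walkGain (fun x => g x.1) l = h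
  have Rtrans : ∀ {a b c h k}, R a b h → R b c k → R a c (h * k) := by
    rintro a b c h k ⟨l, hl, rfl⟩ ⟨m, hm, rfl⟩
    exact ⟨l ++ m, hl.append' hm, walkGain_append _ _ _⟩
  have Rsymm : ∀ {a b h}, R a b h → R b a h⁻¹ := by
    rintro a b h ⟨l, hl, rfl⟩
    exact exists_rev _ hl
  have Rof : ∀ {a b l}, Γ.IsWalkFrom a b l → e ∉ Γ.walkEdges l → R a b (Γ.walkGain g l) := by
    intro a b l hl he
    obtain ⟨m, rfl⟩ := exists_up (S := {e}) l (by
      intro s hs hse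
      exact he (List.mem_map.2 ⟨s, hs, hse⟩))
    exact ⟨m, down_walk hl, (up_gain g m).symm⟩
  -- the improper edge itself
  have hone : ∃ s : Γ.Step, s.1 = e ∧ R (Γ.stepStart s) (Γ.stepEnd s) (Γ.stepGain g s) := by
    obtain ⟨C, ⟨hC, hCe⟩, -⟩ := himp
    obtain ⟨l, ⟨hne, hed, hst⟩, ⟨⟨v, hw⟩, hcount⟩, hg⟩ := hbal C hC
    have he : e ∈ Γ.walkEdges l := by
      by_contra hcon
      apply hCe
      rw [hcount, countIn_eq_zero _ _ hcon]
      simp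
    obtain ⟨s, hs, hse⟩ := List.mem_map.1 he
    obtain ⟨a, b, rfl⟩ := List.append_of_mem hs
    obtain ⟨p, h1, h2⟩ := hw.split'
    obtain ⟨h3, h4⟩ := h2.cons_inv
    subst h3
    have hnd : s.1 ∉ Γ.walkEdges a ∧ s.1 ∉ Γ.walkEdges b := by
      have : (Γ.walkEdges a ++ s.1 :: Γ.walkEdges b).Nodup := by
        simpa [walkEdges] using hed
      have h := List.nodup_middle.1 this
      rw [List.nodup_cons, List.mem_append, not_or] at h
      exact h.1
    rw [hse] at hnd
    refine ⟨s, hse, ?_⟩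
    have := Rsymm (Rtrans (Rof h4 hnd.2) (Rof h1 hnd.1))
    rw [walkGain_append, walkGain_cons] at hg
    have e1 : (Γ.walkGain g b * Γ.walkGain g a)⁻¹ = Γ.stepGain g s := by
      rw [mul_inv_rev, eq_comm, eq_mul_inv_iff_mul_eq]
      exact eq_inv_of_mul_eq_one_right hg
    rwa [e1] at this
  have Rstep : ∀ s : Γ.Step, R (Γ.stepStart s) (Γ.stepEnd s) (Γ.stepGain g s) := by
    intro s
    by_cases hs : s.1 = e
    · obtain ⟨t, ht, hR⟩ := hone
      by_cases hst : s = t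
      · rw [hst]; exact hR
      · have : s = revStep t := by
          rcases s with ⟨x1, x2⟩
          rcases t with ⟨y1, y2⟩
          simp only at hs ht
          subst hs
          subst ht
          cases x2 <;> cases y2 <;> simp_all [revStep]
        rw [this, stepStart_rev, stepEnd_rev, stepGain_rev]
        exact Rsymm hR
    · have := Rof (IsWalkFrom.cons (rfl : Γ.stepStart s = _) (.nil _))
        (by simpa [walkEdges] using Ne.symm hs)
      simpa [walkGain] using this
  have Rall : ∀ {a b l}, Γ.IsWalkFrom a b l → R a b (Γ.walkGain g l) := by
    intro a b l h
    induction h with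
    | nil v => exact Rof (.nil v) (by simp [walkEdges])
    | cons hs _ ih =>
      subst hs
      rw [walkGain_cons]
      exact Rtrans (Rstep _) ih
  intro v l hw _
  obtain ⟨m, hm, hmg⟩ := Rall hw
  rw [← hmg]
  exact hdel.closed _ _ v m le_rfl hm
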